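/- For integers n, k with n − 1 > k ≥ 2, and a field K, let deg R/I_{n,k} denote the degree of R/I_{n,k}, where R = K[x₁,…,xₙ] and I_{n,k} is generated by the (k+1)-minors of the Vandermonde matrix M_{n,k} (similarly for I_{n−1,k−1} and I_{n−1,k} in K[x₁,…,x_{n−1}]). Then deg R/I_{n,k} = deg R'/I_{n−1,k−1} + k · (deg R'/I_{n−1,k}), where R' = K[x₁,…,x_{n−1}]. -/

import Mathlib

open MvPolynomial

/-- The `(k+1) × n` Vandermonde matrix of variables: the `(i,j)` entry is `xⱼ^i`
(rows indexed by `0,…,k`, columns by the variables `x₁,…,xₙ`). -/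
noncomputable def vandermondeMatrix (K : Type*) [Field K] (n k : ℕ) :
    Matrix (Fin (k + 1)) (Fin n) (MvPolynomial (Fin n) K) :=
  Matrix.of fun i j => (X j : MvPolynomial (Fin n) K) ^ (i : ℕ)

/-- The ideal generated by all maximal (i.e. `(k+1)`-size) minors of the
Vandermonde matrix `vandermondeMatrix K n k`. -/
noncomputable def vanIdeal (K : Type*) [Field K] (n k : ℕ) :
    Ideal (MvPolynomial (Fin n) K) :=
  Ideal.span { d | ∃ g : Fin (k + 1) ↪ Fin n,
    d = ((vandermondeMatrix K n k).submatrix id g).det }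

/-- The Hilbert function of `R ⧸ I` for `R = K[x₁,…,xₙ]` standard graded:
`j ↦ dim_K (R ⧸ I)_j`, where `(R ⧸ I)_j` is the image of the space of homogeneous
polynomials of degree `j` in `R ⧸ I`. -/
noncomputable def hilbertFn (K : Type*) [Field K] {n : ℕ}
    (I : Ideal (MvPolynomial (Fin n) K)) (j : ℕ) : ℕ :=
  Module.finrank K ((MvPolynomial.homogeneousSubmodule (Fin n) K j).map
    (Ideal.Quotient.mkₐ K I).toLinearMap)

/-- `hasDegree K I e` says that the standard graded algebra `R ⧸ I` has degree
(multiplicity) `e`: there is a (Hilbert) polynomial `P` agreeing with the Hilbert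
function of `R ⧸ I` in all large degrees, and `e = (d-1)! ·` (leading coefficient
of `P`), where `d` is the Krull dimension of `R ⧸ I`. -/
def hasDegree (K : Type*) [Field K] {n : ℕ}
    (I : Ideal (MvPolynomial (Fin n) K)) (e : ℚ) : Prop :=
  ∃ (P : Polynomial ℚ) (d : ℕ),
    ringKrullDim (MvPolynomial (Fin n) K ⧸ I) = d ∧
    (∀ᶠ j : ℕ in Filter.atTop, (hilbertFn K I j : ℚ) = P.eval (j : ℚ)) ∧
    e = (d - 1).factorial * P.leadingCoeff

/-- The length of the chain `g 0 > g 1 > ⋯` of positions with `i ≤ a (g i)` found greedily, reading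
the tuple `a` from its last entry to its first. -/
def greedyLength : (n : ℕ) → (Fin n → ℕ) → ℕ
  | 0, _ => 0
  | n + 1, a =>
    if greedyLength n (Fin.tail a) ≤ a 0 then greedyLength n (Fin.tail a) + 1
    else greedyLength n (Fin.tail a)

theorem exists_strictAnti_of_greedyLength (n : ℕ) (a : Fin n → ℕ) :
    ∃ g : Fin (greedyLength n a) → Fin n, StrictAnti g ∧
      ∀ i : Fin (greedyLength n a), (i : ℕ) ≤ a (g i) := by
  induction n with
  | zero => exact ⟨Fin.elim0, fun i => i.elim0, fun i => i.elim0⟩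
  | succ n ih =>
    obtain ⟨g, hg, hga⟩ := ih (Fin.tail a)
    by_cases h : greedyLength n (Fin.tail a) ≤ a 0
    · have e : greedyLength (n + 1) a = greedyLength n (Fin.tail a) + 1 := by
        simp [greedyLength, h]
      rw [e]
      refine ⟨Fin.snoc (α := fun _ => Fin (n + 1)) (fun i => (g i).succ) 0, ?_, ?_⟩
      · intro i j hij
        induction j using Fin.lastCases with
        | last =>
          induction i using Fin.lastCases with
          | last => exact absurd hij (lt_irrefl _)
          | cast i => simp [Fin.snoc_castSucc, Fin.snoc_last]
        | cast j =>
          induction i using Fin.lastCases with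
          | last => exact absurd hij (not_lt.mpr (Fin.le_last _))
          | cast i =>
            simp only [Fin.snoc_castSucc]
            exact Fin.succ_lt_succ_iff.mpr (hg (by simpa using hij))
      · intro i
        induction i using Fin.lastCases with
        | last => simpa [Fin.snoc_last] using h
        | cast i => simpa [Fin.snoc_castSucc, Fin.tail] using hga i
    · have e : greedyLength (n + 1) a = greedyLength n (Fin.tail a) := by
        simp [greedyLength, h]
      rw [e]
      exact ⟨fun i => (g i).succ, fun i j hij => Fin.succ_lt_succ_iff.mpr (hg hij), fun i => hga i⟩

theorem sum_range_multichoose_left (k j : ℕ) :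
    ∑ b ∈ Finset.range (j + 1), k.multichoose b = (k + 1).multichoose j := by
  induction j with
  | zero => simp
  | succ j ih => rw [Finset.sum_range_succ, ih, Nat.multichoose_succ_succ, add_comm]

theorem multichoose_mono (k : ℕ) : Monotone (k + 1).multichoose :=
  monotone_nat_of_le_succ fun j => by
    rw [Nat.multichoose_succ_succ]; exact Nat.le_add_left _ _

theorem card_antidiagonalTuple_succ_le (n c j : ℕ) :
    ((Finset.Nat.antidiagonalTuple (n + 1) j).filter (greedyLength (n + 1) · = c)).card ≤
      ∑ p ∈ Finset.HasAntidiagonal.antidiagonal j,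
        ((Finset.Nat.antidiagonalTuple n p.2).filter
          (fun a => (if greedyLength n a ≤ p.1 then greedyLength n a + 1
            else greedyLength n a) = c)).card := by
  rw [← Finset.card_sigma]
  refine Finset.card_le_card_of_injOn
    (fun a => ⟨(a 0, ∑ i, Fin.tail a i), Fin.tail a⟩) ?_ ?_
  · intro a ha
    simp only [Finset.coe_filter, Finset.Nat.mem_antidiagonalTuple, Set.mem_ofPred_eq] at ha
    simp only [Finset.coe_sigma, Set.mem_sigma_iff, Finset.mem_coe,
      Finset.HasAntidiagonal.mem_antidiagonal, Finset.mem_filter,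
      Finset.Nat.mem_antidiagonalTuple, true_and]
    exact ⟨by rw [← ha.1, Fin.sum_univ_succ]; rfl, ha.2⟩
  · intro a _ b _ hab
    simp only [Sigma.mk.injEq, Prod.mk.injEq] at hab
    rw [← Fin.cons_self_tail a, ← Fin.cons_self_tail b, hab.1.1, eq_of_heq hab.2]

theorem card_greedyLength_le (n k j : ℕ) :
    ((Finset.Nat.antidiagonalTuple n j).filter (greedyLength n · = k)).card ≤
      n.stirlingSecond k * k.multichoose j := by
  induction n generalizing k j with
  | zero =>
    rcases k with _ | k
    · rcases j with _ | j
      · exact (Finset.card_filter_le _ _).trans (by simp)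
      · simp
    · simp [greedyLength]
  | succ n ih =>
    rcases k with _ | k
    · have : (Finset.Nat.antidiagonalTuple (n + 1) j).filter (greedyLength (n + 1) · = 0) = ∅ := by
        refine Finset.filter_eq_empty_iff.mpr fun a _ => ?_
        simp only [greedyLength]
        split_ifs with h
        · exact not_false
        · exact fun h0 => h (h0 ▸ Nat.zero_le _)
      simp [this]
    · refine (card_antidiagonalTuple_succ_le n (k + 1) j).trans ?_
      have hbound : ∀ p ∈ Finset.HasAntidiagonal.antidiagonal j,
          ((Finset.Nat.antidiagonalTuple n p.2).filter
            (fun a => (if greedyLength n a ≤ p.1 then greedyLength n a + 1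
              else greedyLength n a) = k + 1)).card ≤
          n.stirlingSecond k * k.multichoose p.2 +
            if p.1 ≤ k then n.stirlingSecond (k + 1) * (k + 1).multichoose j else 0 := by
        intro p hp
        have hsub : (Finset.Nat.antidiagonalTuple n p.2).filter
            (fun a => (if greedyLength n a ≤ p.1 then greedyLength n a + 1
              else greedyLength n a) = k + 1) ⊆
            (Finset.Nat.antidiagonalTuple n p.2).filter (greedyLength n · = k) ∪
              if p.1 ≤ k then
                (Finset.Nat.antidiagonalTuple n p.2).filter (greedyLength n · = k + 1)
              else ∅ := by
          intro a ha
          by_cases hk : p.1 ≤ k <;>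
            simp only [Finset.mem_filter, Finset.mem_union, hk, if_true, if_false,
              Finset.notMem_empty, or_false] at ha ⊢ <;>
            obtain ⟨h1, h2⟩ := ha <;> split_ifs at h2 <;> simp only [h1, true_and] <;> omega
        refine (Finset.card_le_card hsub).trans ((Finset.card_union_le _ _).trans ?_)
        refine Nat.add_le_add (ih k p.2) ?_
        split_ifs
        · exact (ih (k + 1) p.2).trans (Nat.mul_le_mul_left _
            (multichoose_mono k (by have := Finset.HasAntidiagonal.mem_antidiagonal.mp hp; omega)))
        · simp
      refine (Finset.sum_le_sum hbound).trans ?_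
      rw [Finset.sum_add_distrib, Nat.stirlingSecond_succ_succ, add_mul, add_comm]
      refine Nat.add_le_add ?_ ?_
      · rw [Finset.Nat.sum_antidiagonal_eq_sum_range_succ_mk, ← Finset.sum_filter,
          Finset.sum_const, smul_eq_mul, mul_assoc]
        refine Nat.mul_le_mul_right _ ?_
        refine (Finset.card_le_card (t := Finset.range (k + 1)) ?_).trans (by simp)
        intro i hi
        simp only [Finset.mem_filter] at hi
        simp only [Finset.mem_range]; omega
      · rw [← Finset.mul_sum]
        refine Nat.mul_le_mul_left _ ?_
        rw [← Finset.Nat.sum_antidiagonal_swap, Finset.Nat.sum_antidiagonal_eq_sum_range_succ_mk]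
        exact (sum_range_multichoose_left k j).le

theorem stirlingSecond_pos {n k : ℕ} (hk : 1 ≤ k) (hkn : k ≤ n) : 0 < n.stirlingSecond k := by
  induction n generalizing k with
  | zero => omega
  | succ n ih =>
    obtain ⟨k, rfl⟩ := Nat.exists_eq_add_of_le' hk
    rw [Nat.stirlingSecond_succ_succ]
    rcases Nat.eq_or_lt_of_le hkn with h | h
    · have : k = n := by omega
      subst this
      simp [Nat.stirlingSecond_self]
    · have := ih (k := k + 1) (by omega) (by omega)
      positivity

theorem exists_stirlingSecond_labelings (n k : ℕ) :
    ∃ (ι : Type) (_ : Fintype ι) (φ : ι → Fin n → Fin k),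
      Fintype.card ι = n.stirlingSecond k ∧ (∀ s, Function.Surjective (φ s)) ∧
      ∀ s t, (∀ i j, φ s i = φ s j → φ t i = φ t j) → s = t := by
  induction n generalizing k with
  | zero =>
    rcases k with _ | k
    · exact ⟨Unit, inferInstance, fun _ => id, by simp, fun _ => Function.surjective_id,
        fun _ _ _ => rfl⟩
    · exact ⟨Empty, inferInstance, fun s => s.elim, by simp, fun s => s.elim, fun s => s.elim⟩
  | succ n ih =>
    rcases k with _ | k
    · exact ⟨Empty, inferInstance, fun s => s.elim, by simp, fun s => s.elim, fun s => s.elim⟩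
    · obtain ⟨ι₁, _, φ₁, hc₁, hs₁, hi₁⟩ := ih k
      obtain ⟨ι₂, _, φ₂, hc₂, hs₂, hi₂⟩ := ih (k + 1)
      refine ⟨ι₁ ⊕ ι₂ × Fin (k + 1), inferInstance,
        Sum.elim (fun s => Fin.cons (Fin.last k) fun i => (φ₁ s i).castSucc)
          (fun s => Fin.cons s.2 (φ₂ s.1)), ?_, ?_, ?_⟩
      · simp [hc₁, hc₂, Nat.stirlingSecond_succ_succ]; ring
      · rintro (s | ⟨s, c⟩) y
        · induction y using Fin.lastCases with
          | last => exact ⟨0, by simp⟩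
          | cast y =>
            obtain ⟨i, hi⟩ := hs₁ s y
            exact ⟨i.succ, by simp [hi]⟩
        · obtain ⟨i, hi⟩ := hs₂ s y
          exact ⟨i.succ, by simp [hi]⟩
      · rintro (s | ⟨s, c⟩) (t | ⟨t, d⟩) h
        · rw [hi₁ s t fun i j hij => by simpa using h i.succ j.succ (by simpa using hij)]
        · exfalso
          have hker : ∀ i j, φ₁ s i = φ₁ s j → φ₂ t i = φ₂ t j := fun i j hij => by
            simpa using h i.succ j.succ (by simpa using hij)
          choose σ hσ using hs₁ s
          have hsurj : Function.Surjective fun y => φ₂ t (σ y) := fun z => by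
            obtain ⟨i, rfl⟩ := hs₂ t z
            exact ⟨φ₁ s i, hker _ _ (hσ _)⟩
          simpa using Fintype.card_le_of_surjective _ hsurj
        · exfalso
          obtain ⟨i, hi⟩ := hs₂ s c
          have := h 0 i.succ (by simp [hi])
          simp only [Sum.elim_inl, Fin.cons_zero, Fin.cons_succ] at this
          exact Fin.castSucc_ne_last _ this.symm
        · obtain rfl := hi₂ s t fun i j hij => by
            simpa using h i.succ j.succ (by simpa using hij)
          obtain ⟨i, hi⟩ := hs₂ s c
          have := h 0 i.succ (by simp [hi])
          simp only [Sum.elim_inr, Fin.cons_zero, Fin.cons_succ] at this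
          rw [this, hi]

theorem map_vandermonde_minor {K A : Type*} [Field K] [CommRing A] [Algebra K A] {n k : ℕ}
    (f : MvPolynomial (Fin n) K →ₐ[K] A) (g : Fin (k + 1) → Fin n) :
    f ((vandermondeMatrix K n k).submatrix id g).det =
      (Matrix.vandermonde fun i => f (X (g i))).det := by
  rw [AlgHom.map_det, ← Matrix.det_transpose]
  congr 1
  ext i j
  simp [vandermondeMatrix, Matrix.vandermonde]

theorem vanIdeal_le_ker_rename (K : Type*) [Field K] {n k : ℕ} (φ : Fin n → Fin k) :
    vanIdeal K n k ≤ RingHom.ker (rename φ : MvPolynomial (Fin n) K →ₐ[K] _) := by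
  refine Ideal.span_le.mpr ?_
  rintro _ ⟨g, rfl⟩
  rw [SetLike.mem_coe, RingHom.mem_ker, map_vandermonde_minor, Matrix.det_vandermonde_eq_zero_iff]
  obtain ⟨i, j, hij, h⟩ := Fintype.exists_ne_map_eq_of_card_lt (fun i => φ (g i)) (by simp)
  exact ⟨i, j, by simp only [rename_X, h], hij⟩

theorem card_image_le_of_vanIdeal_le_ker {K A : Type*} [Field K] [CommRing A] [IsDomain A]
    [Algebra K A] [DecidableEq A] {n k : ℕ} (f : MvPolynomial (Fin n) K →ₐ[K] A)
    (hf : vanIdeal K n k ≤ RingHom.ker f) :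
    (Finset.univ.image fun i => f (X i)).card ≤ k := by
  by_contra! h
  obtain ⟨t, ht, hcard⟩ := Finset.exists_subset_card_eq (Nat.succ_le_of_lt h)
  have hpre : ∀ a : t, ∃ i, f (X i) = a := fun a => by
    simpa using ht a.2
  choose σ hσ using hpre
  let e : Fin (k + 1) ≃ t := (finCongr (by simp [hcard])).trans t.equivFin.symm
  have hinj : Function.Injective fun i => f (X (σ (e i))) := fun i j hij => by
    simpa [hσ] using hij
  let g : Fin (k + 1) ↪ Fin n := ⟨fun i => σ (e i), fun i j hij => hinj (by
    simp only at hij ⊢; rw [hij])⟩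
  have hmem : ((vandermondeMatrix K n k).submatrix id g).det ∈ vanIdeal K n k :=
    Ideal.subset_span ⟨g, rfl⟩
  have := hf hmem
  rw [RingHom.mem_ker, map_vandermonde_minor] at this
  exact Matrix.det_vandermonde_ne_zero_iff.mpr hinj this

theorem ringKrullDim_le_card_of_surjective_aeval {K A : Type*} [Field K] [CommRing A] [Algebra K A]
    {s : Finset A}
    (h : Function.Surjective (aeval (fun a : s => (a : A)) : MvPolynomial s K →ₐ[K] A)) :
    ringKrullDim A ≤ s.card := by
  refine (ringKrullDim_le_of_surjective (aeval (fun a : s => (a : A))).toRingHom h).trans ?_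
  rw [MvPolynomial.ringKrullDim_of_isNoetherianRing]
  simp [ringKrullDim_eq_zero_of_field]

theorem ringKrullDim_le_of_vanIdeal_le_ker {K A : Type*} [Field K] [CommRing A] [IsDomain A]
    [Algebra K A] {n k : ℕ} (f : MvPolynomial (Fin n) K →ₐ[K] A)
    (hf : vanIdeal K n k ≤ RingHom.ker f) (hsurj : Function.Surjective f) :
    ringKrullDim A ≤ k := by
  classical
  refine (ringKrullDim_le_card_of_surjective_aeval (K := K)
    (s := Finset.univ.image fun i => f (X i)) ?_).trans
    (by exact_mod_cast card_image_le_of_vanIdeal_le_ker f hf)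
  intro a
  obtain ⟨p, rfl⟩ := hsurj a
  refine ⟨rename (fun i => ⟨f (X i), Finset.mem_image_of_mem _ (Finset.mem_univ i)⟩) p, ?_⟩
  rw [aeval_rename]
  refine DFunLike.congr_fun (?_ : _ = f) p
  ext i
  simp

theorem ringKrullDim_le_of_forall_quotient_le {A : Type*} [CommRing A] {d : ℕ}
    (h : ∀ (p : Ideal A) [p.IsPrime], ringKrullDim (A ⧸ p) ≤ d) : ringKrullDim A ≤ d := by
  refine iSup_le fun s => ?_
  have := h s.head.asIdeal
  rw [ringKrullDim_quotient] at this
  let s' : LTSeries (PrimeSpectrum.zeroLocus (R := A) s.head.asIdeal) :=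
    { length := s.length
      toFun := fun i => ⟨s i, s.head_le i⟩
      step := fun i => s.step i }
  exact (le_iSup (fun t : LTSeries _ => (t.length : WithBot ℕ∞)) s').trans this

theorem ringKrullDim_quotient_vanIdeal (K : Type*) [Field K] {n k : ℕ} (hk : 1 ≤ k)
    (hkn : k ≤ n) : ringKrullDim (MvPolynomial (Fin n) K ⧸ vanIdeal K n k) = k := by
  refine le_antisymm (ringKrullDim_le_of_forall_quotient_le fun p _ => ?_) ?_
  · refine ringKrullDim_le_of_vanIdeal_le_ker
      ((Ideal.Quotient.mkₐ K p).comp (Ideal.Quotient.mkₐ K (vanIdeal K n k))) ?_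
      ((Ideal.Quotient.mkₐ_surjective K p).comp (Ideal.Quotient.mkₐ_surjective K _))
    intro x hx
    rw [RingHom.mem_ker, AlgHom.comp_apply, Ideal.Quotient.mkₐ_eq_mk K (vanIdeal K n k),
      Ideal.Quotient.eq_zero_iff_mem.mpr hx, map_zero]
  · let φ : Fin n → Fin k := fun i => if h : (i : ℕ) < k then ⟨i, h⟩ else ⟨0, hk⟩
    have hφ : Function.Surjective φ := fun y => ⟨⟨y, by omega⟩, by simp [φ]⟩
    have hsurj : Function.Surjective (Ideal.Quotient.lift (vanIdeal K n k)
        (rename φ : MvPolynomial (Fin n) K →ₐ[K] _).toRingHom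
        fun a ha => vanIdeal_le_ker_rename K φ ha) :=
      Ideal.Quotient.lift_surjective_of_surjective _ _ (rename_surjective φ hφ)
    refine le_trans ?_ (ringKrullDim_le_of_surjective _ hsurj)
    rw [MvPolynomial.ringKrullDim_of_isNoetherianRing]
    simp [ringKrullDim_eq_zero_of_field]

theorem vandermonde_minor_eq_prod (K : Type*) [Field K] {n k : ℕ} (g : Fin (k + 1) → Fin n) :
    ((vandermondeMatrix K n k).submatrix id g).det =
      ∏ i, ∏ j ∈ Finset.Ioi i, (X (g j) - X (g i) : MvPolynomial (Fin n) K) := by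
  rw [← Matrix.det_vandermonde]
  exact map_vandermonde_minor (AlgHom.id K _) g

theorem isHomogeneous_vanIdeal (K : Type*) [Field K] (n k : ℕ) :
    letI := MvPolynomial.gradedAlgebra (σ := Fin n) (R := K)
    (vanIdeal K n k).IsHomogeneous (homogeneousSubmodule (Fin n) K) := by
  let := MvPolynomial.gradedAlgebra (σ := Fin n) (R := K)
  refine Ideal.homogeneous_span _ _ ?_
  rintro _ ⟨g, rfl⟩
  rw [vandermonde_minor_eq_prod]
  exact ⟨_, IsHomogeneous.prod _ _ _ fun i _ => IsHomogeneous.prod _ _ _ fun j _ =>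
    (isHomogeneous_X K (g j)).sub (isHomogeneous_X K (g i))⟩

theorem degree_X_lt_degree_X_lex (K : Type*) [Field K] {n : ℕ} {a b : Fin n} (h : a < b) :
    MonomialOrder.lex.toSyn (MonomialOrder.lex.degree (X b : MvPolynomial (Fin n) K)) <
      MonomialOrder.lex.toSyn (MonomialOrder.lex.degree (X a : MvPolynomial (Fin n) K)) := by
  rw [MonomialOrder.degree_X, MonomialOrder.degree_X, MonomialOrder.lex_lt_iff]
  exact Finsupp.Lex.single_lt_iff.mpr h

theorem monic_vandermonde_minor (K : Type*) [Field K] {n k : ℕ} {g : Fin (k + 1) → Fin n}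
    (hg : StrictAnti g) :
    MonomialOrder.lex.Monic ((vandermondeMatrix K n k).submatrix id g).det := by
  rw [vandermonde_minor_eq_prod]
  refine MonomialOrder.Monic.prod fun i _ => MonomialOrder.Monic.prod fun j hj => ?_
  rw [MonomialOrder.Monic, MonomialOrder.leadingCoeff_sub_of_lt
    (degree_X_lt_degree_X_lex K (hg (Finset.mem_Ioi.mp hj)))]
  exact MonomialOrder.monic_X

theorem degree_vandermonde_minor (K : Type*) [Field K] {n k : ℕ} {g : Fin (k + 1) → Fin n}
    (hg : StrictAnti g) :
    MonomialOrder.lex.degree ((vandermondeMatrix K n k).submatrix id g).det =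
      ∑ j, Finsupp.single (g j) (j : ℕ) := by
  have hX : ∀ i, ∀ j ∈ Finset.Ioi i, (X (g j) - X (g i) : MvPolynomial (Fin n) K) ≠ 0 :=
    fun i j hj => sub_ne_zero.mpr fun h =>
      (Finset.mem_Ioi.mp hj).ne' (hg.injective (X_injective h))
  rw [vandermonde_minor_eq_prod, MonomialOrder.degree_prod
    fun i _ => Finset.prod_ne_zero_iff.mpr (hX i)]
  calc _ = ∑ i, ∑ j ∈ Finset.Ioi i, Finsupp.single (g j) 1 := by
        refine Finset.sum_congr rfl fun i _ => ?_
        rw [MonomialOrder.degree_prod (hX i)]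
        refine Finset.sum_congr rfl fun j hj => ?_
        rw [MonomialOrder.degree_sub_of_lt
          (degree_X_lt_degree_X_lex K (hg (Finset.mem_Ioi.mp hj))), MonomialOrder.degree_X]
    _ = ∑ j, ∑ i ∈ Finset.Iio j, Finsupp.single (g j) 1 :=
        Finset.sum_comm' fun i j => by simp
    _ = _ := by
        refine Finset.sum_congr rfl fun j _ => ?_
        rw [Finset.sum_const, Fin.card_Iio, Finsupp.smul_single, smul_eq_mul, mul_one]

theorem exists_degree_vandermonde_minor_le (K : Type*) [Field K] {n k : ℕ} {a : Fin n →₀ ℕ}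
    (ha : k < greedyLength n a) :
    ∃ g : Fin (k + 1) → Fin n, StrictAnti g ∧
      MonomialOrder.lex.degree ((vandermondeMatrix K n k).submatrix id g).det ≤ a := by
  obtain ⟨g, hg, hga⟩ := exists_strictAnti_of_greedyLength n a
  have hg' : StrictAnti fun i : Fin (k + 1) => g (Fin.castLE ha i) :=
    fun i j hij => hg (by simpa using hij)
  refine ⟨_, hg', ?_⟩
  rw [degree_vandermonde_minor K hg']
  intro x
  rw [Finsupp.finsetSum_apply]
  by_cases hx : ∃ m : Fin (k + 1), g (Fin.castLE ha m) = x
  · obtain ⟨m, rfl⟩ := hx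
    rw [Finset.sum_eq_single m (fun b _ hb => Finsupp.single_eq_of_ne
      fun h => hb (hg'.injective h.symm)) (by simp)]
    simpa using hga (Fin.castLE ha m)
  · rw [Finset.sum_eq_zero]
    · exact Nat.zero_le _
    · exact fun m _ => Finsupp.single_eq_of_ne fun h => hx ⟨m, h.symm⟩

theorem exists_sub_mem_vanIdeal (K : Type*) [Field K] {n k j : ℕ} {f : MvPolynomial (Fin n) K}
    (hf : f.IsHomogeneous j) :
    ∃ r : MvPolynomial (Fin n) K, r.IsHomogeneous j ∧ f - r ∈ vanIdeal K n k ∧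
      ∀ a ∈ r.support, greedyLength n a ≤ k := by
  let B : Set (MvPolynomial (Fin n) K) :=
    {d | ∃ g : Fin (k + 1) → Fin n, StrictAnti g ∧
      d = ((vandermondeMatrix K n k).submatrix id g).det}
  have hBI : B ⊆ vanIdeal K n k := by
    rintro _ ⟨g, hg, rfl⟩
    exact Ideal.subset_span ⟨⟨g, hg.injective⟩, rfl⟩
  obtain ⟨q, r, hfr, -, hr⟩ := MonomialOrder.lex.div_set (B := B) (fun b hb => by
    obtain ⟨g, hg, rfl⟩ := hb
    rw [(monic_vandermonde_minor K hg).leadingCoeff_eq_one]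
    exact isUnit_one) f
  have hmem : f - r ∈ vanIdeal K n k := by
    rw [hfr, add_sub_cancel_right, Finsupp.linearCombination_apply]
    exact Ideal.sum_mem _ fun b _ => Ideal.mul_mem_left _ _ (hBI b.2)
  refine ⟨homogeneousComponent j r, homogeneousComponent_isHomogeneous j r, ?_, fun a ha => ?_⟩
  · have := homogeneousComponent_mem_of_mem (isHomogeneous_vanIdeal K n k) hmem j
    rwa [map_sub, homogeneousComponent_eq_self hf] at this
  · by_contra! hlt
    obtain ⟨g, hg, hle⟩ := exists_degree_vandermonde_minor_le K hlt
    rw [support_homogeneousComponent] at ha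
    exact hr a (Finset.mem_filter.mp ha).1 _ ⟨g, hg, rfl⟩ hle

theorem hilbertFn_vanIdeal_le (K : Type*) [Field K] (n k j : ℕ) :
    hilbertFn K (vanIdeal K n k) j ≤
      ∑ c ∈ Finset.range (k + 1), n.stirlingSecond c * c.multichoose j := by
  classical
  let T := (Finset.Nat.antidiagonalTuple n j).filter (greedyLength n · ≤ k)
  let S := T.image fun a => Ideal.Quotient.mk (vanIdeal K n k)
    (monomial (Finsupp.equivFunOnFinite.symm a) 1)
  have hle : (homogeneousSubmodule (Fin n) K j).map
      (Ideal.Quotient.mkₐ K (vanIdeal K n k)).toLinearMap ≤ Submodule.span K S := by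
    rintro _ ⟨f, hf, rfl⟩
    obtain ⟨r, hr, hmem, hsupp⟩ := exists_sub_mem_vanIdeal K (k := k) hf
    have : (Ideal.Quotient.mkₐ K (vanIdeal K n k)).toLinearMap f =
        (Ideal.Quotient.mkₐ K (vanIdeal K n k)).toLinearMap r :=
      Ideal.Quotient.eq.mpr hmem
    rw [this, r.as_sum, map_sum]
    refine Submodule.sum_mem _ fun a ha => ?_
    rw [← mul_one (coeff a r), ← smul_eq_mul, ← smul_monomial, map_smul]
    refine Submodule.smul_mem _ _ (Submodule.subset_span (Finset.mem_coe.mpr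
      (Finset.mem_image.mpr ⟨a, Finset.mem_filter.mpr ⟨?_, hsupp a ha⟩, ?_⟩)))
    · rw [Finset.Nat.mem_antidiagonalTuple, ← Finsupp.degree_eq_sum]
      rw [Finsupp.degree_eq_weight_one]
      exact hr (mem_support_iff.mp ha)
    · simp
  calc
    _ ≤ Module.finrank K (Submodule.span K (S : Set (MvPolynomial (Fin n) K ⧸ vanIdeal K n k))) :=
        Submodule.finrank_mono hle
    _ ≤ S.card := finrank_span_finset_le_card S
    _ ≤ T.card := Finset.card_image_le
    _ = ∑ c ∈ Finset.range (k + 1), (T.filter (greedyLength n · = c)).card :=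
        Finset.card_eq_sum_card_fiberwise fun a ha => by
          simpa [Nat.lt_succ_iff] using (Finset.mem_filter.mp ha).2
    _ ≤ _ := Finset.sum_le_sum fun c _ =>
        (Finset.card_le_card (Finset.filter_subset_filter _ (Finset.filter_subset _ _))).trans
          (card_greedyLength_le n c j)

theorem finrank_homogeneousSubmodule_fin (K : Type*) [Field K] (k m : ℕ) :
    Module.finrank K (homogeneousSubmodule (Fin k) K m) = k.multichoose m := by
  have hset : {d : Fin k →₀ ℕ | d.degree = m} =
      (Finset.finsuppAntidiag (Finset.univ : Finset (Fin k)) m : Set (Fin k →₀ ℕ)) := by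
    ext d
    simp [Finset.mem_finsuppAntidiag, Finsupp.degree_eq_sum]
  rw [homogeneousSubmodule_eq_finsupp_supported,
    (AddMonoidAlgebra.supportedEquivFinsupp _).finrank_eq, hset, Module.finrank_finsupp_self,
    ← Nat.card_eq_fintype_card, Nat.card_coe_set_eq, Set.ncard_coe_finset,
    Finset.card_finsuppAntidiag_nat_eq_multichoose, Finset.card_univ, Fintype.card_fin]

theorem card_mul_multichoose_le_hilbertFn {K ι : Type*} [Field K] [Fintype ι] {n k D : ℕ}
    {I : Ideal (MvPolynomial (Fin n) K)} {φ : ι → Fin n → Fin k}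
    (hI : ∀ s, I ≤ RingHom.ker (rename (φ s) : MvPolynomial (Fin n) K →ₐ[K] _))
    (hφ : ∀ s, Function.Surjective (φ s)) {f : ι → MvPolynomial (Fin n) K}
    (hf : ∀ s, (f s).IsHomogeneous D) (hne : ∀ s, rename (φ s) (f s) ≠ 0)
    (hzero : ∀ s t, s ≠ t → rename (φ t) (f s) = 0) (m : ℕ) :
    Fintype.card ι * k.multichoose m ≤ hilbertFn K I (D + m) := by
  classical
  choose σ hσ using hφ
  let L : (ι → homogeneousSubmodule (Fin k) K m) →ₗ[K] MvPolynomial (Fin n) K :=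
    ∑ s, LinearMap.mulLeft K (f s) ∘ₗ (rename (σ s)).toLinearMap ∘ₗ
      (homogeneousSubmodule (Fin k) K m).subtype ∘ₗ LinearMap.proj s
  have hL : ∀ g, L g = ∑ s, f s * rename (σ s) (g s : MvPolynomial (Fin k) K) := fun g => by
    simp [L]
  have hLhom : ∀ g, L g ∈ homogeneousSubmodule (Fin n) K (D + m) := fun g => by
    rw [hL]
    exact Submodule.sum_mem _ fun s _ => (hf s).mul (IsHomogeneous.rename_isHomogeneous (g s).2)
  let q := (Ideal.Quotient.mkₐ K I).toLinearMap
  let Lq : (ι → homogeneousSubmodule (Fin k) K m) →ₗ[K]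
      (homogeneousSubmodule (Fin n) K (D + m)).map q :=
    (q ∘ₗ L).codRestrict _ fun g => Submodule.mem_map_of_mem (hLhom g)
  have hinj : Function.Injective Lq := by
    refine (injective_iff_map_eq_zero _).mpr fun g hg => funext fun t => Subtype.ext ?_
    have hmem : L g ∈ I := Ideal.Quotient.eq_zero_iff_mem.mp (congrArg Subtype.val hg)
    have := hI t hmem
    rw [RingHom.mem_ker, hL, map_sum, Finset.sum_eq_single t
      (fun s _ hs => by rw [map_mul, hzero s t hs, zero_mul]) (by simp), map_mul,
      rename_rename, mul_eq_zero] at this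
    have hid : φ t ∘ σ t = id := funext (hσ t)
    rw [hid, rename_id_apply] at this
    exact this.resolve_left (hne t)
  have : Module.Finite K (homogeneousSubmodule (Fin n) K (D + m)) :=
    Module.Finite.iff_fg.mpr (homogeneousSubmodule_fg (Fin n) K (D + m))
  have hfin : ∀ _ : ι, Module.Finite K (homogeneousSubmodule (Fin k) K m) := fun _ =>
    Module.Finite.iff_fg.mpr (homogeneousSubmodule_fg (Fin k) K m)
  have h := LinearMap.finrank_le_finrank_of_injective hinj
  rwa [Module.finrank_pi_fintype, Finset.sum_const, finrank_homogeneousSubmodule_fin,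
    Finset.card_univ, smul_eq_mul] at h

theorem le_hilbertFn_vanIdeal (K : Type*) [Field K] (n k m : ℕ) :
    n.stirlingSecond k * k.multichoose m ≤
      hilbertFn K (vanIdeal K n k) (n.stirlingSecond k - 1 + m) := by
  classical
  obtain ⟨ι, _, φ, hcard, hsurj, hsep⟩ := exists_stirlingSecond_labelings n k
  have hsep' : ∀ s t, ∃ l : MvPolynomial (Fin n) K, l.IsHomogeneous 1 ∧
      (s ≠ t → rename (φ t) l = 0 ∧ rename (φ s) l ≠ 0) := fun s t => by
    by_cases h : s = t
    · exact ⟨0, isHomogeneous_zero _ _ _, fun h' => absurd h h'⟩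
    · have : ∃ i j, φ t i = φ t j ∧ φ s i ≠ φ s j := by
        by_contra! hcon
        exact h (hsep t s hcon).symm
      obtain ⟨i, j, hij, hne⟩ := this
      refine ⟨X i - X j, (isHomogeneous_X K i).sub (isHomogeneous_X K j), fun _ => ⟨?_, ?_⟩⟩
      · rw [map_sub, rename_X, rename_X, hij, sub_self]
      · rw [map_sub, rename_X, rename_X, sub_ne_zero]
        exact fun h' => hne (X_injective h')
  choose l hl hlφ using hsep'
  rw [← hcard]
  refine card_mul_multichoose_le_hilbertFn (φ := φ)
    (f := fun s => ∏ t ∈ Finset.univ.erase s, l s t)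
    (fun s => vanIdeal_le_ker_rename K (φ s)) hsurj (fun s => ?_) (fun s => ?_)
    (fun s t hst => ?_) m
  · simpa [Finset.card_erase_of_mem] using
      IsHomogeneous.prod (Finset.univ.erase s) (l s) (fun _ => 1) fun t _ => hl s t
  · rw [map_prod, Finset.prod_ne_zero_iff]
    exact fun t ht => (hlφ s t (Finset.ne_of_mem_erase ht).symm).2
  · rw [map_prod]
    exact Finset.prod_eq_zero (Finset.mem_erase.mpr ⟨hst.symm, Finset.mem_univ t⟩)
      (hlφ s t hst).1

open Filter Topology in
theorem tendsto_multichoose_div_pow (c D : ℕ) :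
    Tendsto (fun j : ℕ => ((c + 1).multichoose (j - D) : ℚ) / (j : ℚ) ^ c) atTop
      (𝓝 (1 / (c.factorial : ℚ))) := by
  let Q : Polynomial ℚ := Polynomial.C (1 / (c.factorial : ℚ)) *
    (ascPochhammer ℚ c).comp (Polynomial.X + Polynomial.C (1 - D : ℚ))
  have hc : (1 / (c.factorial : ℚ)) ≠ 0 := by positivity
  have hlc : Q.leadingCoeff = 1 / (c.factorial : ℚ) := by
    rw [Polynomial.leadingCoeff_mul, Polynomial.leadingCoeff_comp
        (by rw [Polynomial.natDegree_X_add_C]; exact one_ne_zero),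
      Polynomial.leadingCoeff_X_add_C, (monic_ascPochhammer ℚ c).leadingCoeff]
    simp
  have hQ0 : Q ≠ 0 := by
    rw [← Polynomial.leadingCoeff_ne_zero, hlc]; exact hc
  have hdeg : Q.degree = (Polynomial.X ^ c : Polynomial ℚ).degree := by
    rw [Polynomial.degree_X_pow, Polynomial.degree_eq_natDegree hQ0,
      Polynomial.natDegree_C_mul hc, Polynomial.natDegree_comp, ascPochhammer_natDegree,
      Polynomial.natDegree_X_add_C, mul_one]
  have := (Polynomial.div_tendsto_atTop_leadingCoeff_div_of_degree_eq Q _ hdeg).comp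
    (tendsto_natCast_atTop_atTop (R := ℚ))
  rw [hlc, Polynomial.leadingCoeff_X_pow, div_one] at this
  refine this.congr' ?_
  filter_upwards [eventually_ge_atTop D] with j hj
  obtain ⟨i, rfl⟩ := Nat.exists_eq_add_of_le hj
  have he : (((D + i : ℕ) : ℚ) + (1 - D : ℚ)) = ((i + 1 : ℕ) : ℚ) := by push_cast; ring
  have hchoose : (c + 1).multichoose i = (i + c).choose c := by
    rw [Nat.multichoose_eq, show c + 1 + i - 1 = i + c by omega, Nat.choose_symm_add]
  simp only [Function.comp_apply, Q, Polynomial.eval_mul, Polynomial.eval_C, Polynomial.eval_comp,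
    Polynomial.eval_add, Polynomial.eval_X, Polynomial.eval_pow, he]
  rw [← ascPochhammer_eval_cast, ascPochhammer_nat_eq_ascFactorial,
    Nat.ascFactorial_eq_factorial_mul_choose, Nat.add_sub_cancel_left, hchoose]
  push_cast
  field_simp

open Filter Topology in
theorem tendsto_multichoose_div_pow_of_lt {c m : ℕ} (h : c ≤ m) :
    Tendsto (fun j : ℕ => (c.multichoose j : ℚ) / (j : ℚ) ^ m) atTop (𝓝 0) := by
  rcases c with _ | c
  · refine tendsto_const_nhds.congr' ?_
    filter_upwards [eventually_ge_atTop 1] with j hj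
    obtain ⟨j, rfl⟩ := Nat.exists_eq_add_of_le' hj
    simp
  · have h1 := tendsto_multichoose_div_pow c 0
    have h2 : Tendsto (fun j : ℕ => ((j : ℚ) ^ (m - c))⁻¹) atTop (𝓝 0) :=
      tendsto_inv_atTop_zero.comp
        ((tendsto_pow_atTop (by omega)).comp (tendsto_natCast_atTop_atTop (R := ℚ)))
    have h3 := h1.mul h2
    rw [mul_zero] at h3
    refine h3.congr fun j => ?_
    rw [Nat.sub_zero, ← div_eq_mul_inv, div_div, ← pow_add, Nat.add_sub_cancel' (by omega)]

open Filter Topology in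
theorem leadingCoeff_eq_of_tendsto_eval_div_pow {P : Polynomial ℚ} {m : ℕ} {c : ℚ} (hc : c ≠ 0)
    (h : Tendsto (fun j : ℕ => P.eval (j : ℚ) / (j : ℚ) ^ m) atTop (𝓝 c)) :
    P.leadingCoeff = c := by
  have hX : (Polynomial.X ^ m : Polynomial ℚ) ≠ 0 := pow_ne_zero _ Polynomial.X_ne_zero
  have hcast := tendsto_natCast_atTop_atTop (R := ℚ)
  rcases lt_trichotomy P.degree (Polynomial.X ^ m : Polynomial ℚ).degree with hd | hd | hd
  · have := (Polynomial.div_tendsto_atTop_zero_of_degree_lt P _ hd).comp hcast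
    exact absurd (tendsto_nhds_unique h (by simpa [Function.comp_def] using this)) hc
  · have := (Polynomial.div_tendsto_atTop_leadingCoeff_div_of_degree_eq P _ hd).comp hcast
    simpa using tendsto_nhds_unique (by simpa [Function.comp_def] using this) h
  · have := (Polynomial.abs_div_tendsto_atTop_atTop_of_degree_gt P _ hd hX).comp hcast
    refine absurd h.abs (not_tendsto_nhds_of_tendsto_atTop ?_ _)
    simpa [Function.comp_def] using this

open Filter Topology in
theorem tendsto_hilbertFn_vanIdeal_div_pow (K : Type*) [Field K] (n m : ℕ) :
    Tendsto (fun j : ℕ => (hilbertFn K (vanIdeal K n (m + 1)) j : ℚ) / (j : ℚ) ^ m) atTop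
      (𝓝 (n.stirlingSecond (m + 1) / m.factorial)) := by
  set S := n.stirlingSecond (m + 1) with hS
  have hlow : Tendsto (fun j : ℕ => (S : ℚ) *
      (((m + 1).multichoose (j - (S - 1)) : ℚ) / (j : ℚ) ^ m)) atTop (𝓝 (S / m.factorial)) := by
    rw [div_eq_mul_one_div]
    exact (tendsto_multichoose_div_pow m (S - 1)).const_mul _
  have hup : Tendsto (fun j : ℕ =>
      (∑ c ∈ Finset.range (m + 1),
        (n.stirlingSecond c : ℚ) * ((c.multichoose j : ℚ) / (j : ℚ) ^ m)) +
        (S : ℚ) * (((m + 1).multichoose (j - 0) : ℚ) / (j : ℚ) ^ m)) atTop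
      (𝓝 (S / m.factorial)) := by
    have h0 : (S : ℚ) / m.factorial = (∑ c ∈ Finset.range (m + 1), (n.stirlingSecond c : ℚ) * 0) +
        S * (1 / m.factorial) := by simp [div_eq_mul_inv]
    rw [h0]
    exact (tendsto_finsetSum _ fun c hc => (tendsto_multichoose_div_pow_of_lt
      (Nat.lt_succ_iff.mp (Finset.mem_range.mp hc))).const_mul _).add
      ((tendsto_multichoose_div_pow m 0).const_mul _)
  refine tendsto_of_tendsto_of_tendsto_of_le_of_le' hlow hup ?_ ?_
  · filter_upwards [eventually_ge_atTop (S - 1)] with j hj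
    rw [← mul_div_assoc]
    gcongr
    have := le_hilbertFn_vanIdeal K n (m + 1) (j - (S - 1))
    rw [← hS, Nat.add_sub_cancel' hj] at this
    exact_mod_cast this
  · filter_upwards with j
    simp_rw [← mul_div_assoc]
    rw [← Finset.sum_div, ← add_div]
    gcongr
    have := hilbertFn_vanIdeal_le K n (m + 1) j
    rw [Finset.sum_range_succ] at this
    exact_mod_cast this

theorem eq_stirlingSecond_of_hasDegree_vanIdeal {K : Type*} [Field K] {n k : ℕ} {e : ℚ}
    (hk : 1 ≤ k) (hkn : k ≤ n) (h : hasDegree K (vanIdeal K n k) e) :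
    e = n.stirlingSecond k := by
  obtain ⟨P, d, hd, hP, rfl⟩ := h
  rw [ringKrullDim_quotient_vanIdeal K hk hkn] at hd
  obtain rfl : k = d := by exact_mod_cast hd
  have hpos := stirlingSecond_pos hk hkn
  obtain ⟨m, rfl⟩ := Nat.exists_eq_add_of_le' hk
  rw [leadingCoeff_eq_of_tendsto_eval_div_pow (by positivity)
    ((tendsto_hilbertFn_vanIdeal_div_pow K n m).congr' (hP.mono fun j hj => by rw [hj])),
    Nat.add_sub_cancel]
  field_simp

/-- The recursion for degrees:
`deg R/I_{n,k} = deg R'/I_{n-1,k-1} + k · deg R'/I_{n-1,k}` for `n - 1 > k ≥ 2`,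
where `R = K[x₁,…,xₙ]` and `R' = K[x₁,…,x_{n-1}]`. -/
theorem vanIdeal_degree_recursion (K : Type*) [Field K] (n k : ℕ)
    (hk : 2 ≤ k) (hn : k < n - 1) (e₁ e₂ e₃ : ℚ)
    (h₁ : hasDegree K (vanIdeal K n k) e₁)
    (h₂ : hasDegree K (vanIdeal K (n - 1) (k - 1)) e₂)
    (h₃ : hasDegree K (vanIdeal K (n - 1) k) e₃) :
    e₁ = e₂ + k * e₃ := by
  rw [eq_stirlingSecond_of_hasDegree_vanIdeal (by omega) (by omega) h₁,
    eq_stirlingSecond_of_hasDegree_vanIdeal (by omega) (by omega) h₂,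
    eq_stirlingSecond_of_hasDegree_vanIdeal (by omega) (by omega) h₃]
  obtain ⟨n, rfl⟩ := Nat.exists_eq_add_of_le' (show 1 ≤ n by omega)
  rw [Nat.stirlingSecond_succ_left n k (by omega), Nat.add_sub_cancel]
  push_cast
  ring
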